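/- arXiv:2108.06560 — 2 statements merged into one kernel-verified Lean document; each statement's English description precedes it below -/
import Mathlib

section
/- Let n ≥ 1 and 0 ≤ l ≤ g. If δ^n lies in the closure of W_l but not in W_l itself, then there exists j ∈ {1, …, g} such that (δ^{(j)})^{n−1} lies in the closure of W^{(j)}_{l−2}, where δ^{(j)} = π_j(δ). -/
/-- The map `r_b` on `ℂ ∪ {∞}` (modelled as `Option ℂ`, with `none = ∞`). -/
noncomputable def rr (b : ℂ) : Option ℂ → ℂ :=
  fun z => z.elim 1 (fun w => (w - b) / (w - b⁻¹))

/-- A point of `ℂ ∪ {∞}` avoids all the `b_i^{±1}`. -/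
def Allowed {g : ℕ} (b : Fin g → ℂ) (w : Option ℂ) : Prop :=
  ∀ i, w ≠ some (b i) ∧ w ≠ some (b i)⁻¹

/-- `W_l` for a natural number `l`. -/
def Wn {g : ℕ} (b : Fin g → ℂ) (l : ℕ) : Set (Fin g → ℂ) :=
  {x | ∃ z : Fin l → Option ℂ, (∀ j, Allowed b (z j)) ∧ ∀ i, x i = ∏ j, rr (b i) (z j)}

/-- `W_l` for an integer `l` (empty for negative `l`). -/
def W {g : ℕ} (b : Fin g → ℂ) (l : ℤ) : Set (Fin g → ℂ) :=
  {x | ∃ m : ℕ, (m : ℤ) = l ∧ x ∈ Wn b m}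

/-- The torus `(ℂ^×)^g` inside `ℂ^g`. -/
def Torus (g : ℕ) : Set (Fin g → ℂ) := {x | ∀ i, x i ≠ 0}

/-- Closure taken inside the torus `(ℂ^×)^g` (Euclidean topology). -/
noncomputable def closT {g : ℕ} (S : Set (Fin g → ℂ)) : Set (Fin g → ℂ) :=
  closure S ∩ Torus g

/-- The increasing map `Fin (g-1) → Fin g` skipping the index `j`. -/
def skip {g : ℕ} (j : Fin g) (i : Fin (g - 1)) : Fin g :=
  if (i : ℕ) < (j : ℕ) then ⟨i, by have := i.2; omega⟩
  else ⟨(i : ℕ) + 1, by have := i.2; omega⟩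

open Filter Topology

theorem rr_inv (c : ℂ) (z : Option ℂ) : rr c⁻¹ z = (rr c z)⁻¹ := by
  cases z <;> simp [rr]

theorem rr_ne_zero {c : ℂ} {z : Option ℂ} (h₁ : z ≠ some c) (h₂ : z ≠ some c⁻¹) :
    rr c z ≠ 0 := by
  cases z with
  | none => simp [rr]
  | some w =>
    exact div_ne_zero (sub_ne_zero.2 fun h => h₁ (congrArg some h))
      (sub_ne_zero.2 fun h => h₂ (congrArg some h))

/-- `r_c` is continuous on `ℂ ∪ {∞}` away from its pole `c⁻¹`. -/
theorem continuousAt_rr (c : ℂ) (z : OnePoint ℂ) (hz : z ≠ ((c⁻¹ : ℂ) : OnePoint ℂ)) :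
    ContinuousAt (fun z : OnePoint ℂ => rr c z) z := by
  induction z using OnePoint.rec with
  | infty =>
    rw [OnePoint.continuousAt_infty', coclosedCompact_eq_cocompact,
      ← Metric.cobounded_eq_cocompact]
    have hsub : Tendsto (fun w : ℂ => (w - c⁻¹)⁻¹) (Bornology.cobounded ℂ) (𝓝 0) :=
      tendsto_inv₀_cobounded.comp (tendsto_sub_const_cobounded c⁻¹)
    have hlim : Tendsto (fun w : ℂ => 1 + (c⁻¹ - c) * (w - c⁻¹)⁻¹)
        (Bornology.cobounded ℂ) (𝓝 1) := by
      simpa using (hsub.const_mul (c⁻¹ - c)).const_add 1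
    refine hlim.congr' ?_
    filter_upwards [Bornology.eventually_ne_cobounded c⁻¹] with w hw
    have hw' : w - c⁻¹ ≠ 0 := sub_ne_zero.2 hw
    change _ = (w - c) / (w - c⁻¹)
    rw [eq_div_iff hw', add_mul, mul_assoc, inv_mul_cancel₀ hw']
    ring
  | coe w =>
    rw [OnePoint.continuousAt_coe]
    have hw : w - c⁻¹ ≠ 0 := sub_ne_zero.2 fun h => hz (congrArg _ h)
    change ContinuousAt (fun w : ℂ => (w - c) / (w - c⁻¹)) w
    fun_prop (disch := assumption)

theorem tendsto_rr {ι : Type*} {U : Filter (ι → OnePoint ℂ)} {ζ : ι → OnePoint ℂ}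
    (hU : U ≤ 𝓝 ζ) {c : ℂ} {k : ι} (hk : ζ k ≠ ((c⁻¹ : ℂ) : OnePoint ℂ)) :
    Tendsto (fun z : ι → OnePoint ℂ => rr c (z k)) U (𝓝 (rr c (ζ k))) :=
  (continuousAt_rr c (ζ k) hk).tendsto.comp (((continuous_apply k).tendsto ζ).mono_left hU)

/-- If a product of values of `r_c` has a nonzero limit and one factor tends to the zero of `r_c`,
then another one tends to its pole. -/
theorem exists_eq_pole {ι : Type*} [Fintype ι] {U : Filter (ι → OnePoint ℂ)} [U.NeBot]
    {ζ : ι → OnePoint ℂ} (hU : U ≤ 𝓝 ζ) {c x : ℂ} (hx : x ≠ 0)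
    (hlim : Tendsto (fun z : ι → OnePoint ℂ => ∏ k, rr c (z k)) U (𝓝 x))
    {k : ι} (hk : ζ k = (c : OnePoint ℂ)) :
    ∃ k', ζ k' = ((c⁻¹ : ℂ) : OnePoint ℂ) := by
  by_contra! hne
  have hprod := tendsto_finsetProd Finset.univ fun k' _ => tendsto_rr hU (hne k')
  apply hx
  rw [tendsto_nhds_unique hlim hprod]
  refine Finset.prod_eq_zero (Finset.mem_univ k) ?_
  rw [hk]
  change (c - c) / (c - c⁻¹) = 0
  simp

theorem rr_mul_rr_inv {a c : ℂ} (ha : a ≠ 0) (hc : c ≠ 0) (hac : a ≠ c) (hac' : a ≠ c⁻¹) :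
    rr c (some a) * rr c (some a⁻¹) = c ^ 2 := by
  change (a - c) / (a - c⁻¹) * ((a⁻¹ - c) / (a⁻¹ - c⁻¹)) = c ^ 2
  have h₁ : a - c⁻¹ ≠ 0 := sub_ne_zero.2 hac'
  have h₂ : a⁻¹ - c⁻¹ ≠ 0 := sub_ne_zero.2 fun h => hac (inv_injective h)
  rw [div_mul_div_comm, div_eq_iff (mul_ne_zero h₁ h₂)]
  field_simp
  ring

theorem skip_ne {g : ℕ} (j : Fin g) (i : Fin (g - 1)) : skip j i ≠ j := by
  intro h
  have h' := congrArg Fin.val h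
  unfold skip at h'
  split_ifs at h' <;> simp at h' <;> omega

/-- If `δ^n` lies in the closure of `W_l` but not in `W_l`, then for some `j` the power
`(δ^{(j)})^{n-1}` lies in the closure of `W^{(j)}_{l-2}`. -/
theorem stmt6 (g : ℕ) (hg : 1 ≤ g) (ρ β b : Fin g → ℂ)
    (hρdist : Function.Injective ρ) (hρ1 : ∀ i, ρ i ≠ 1 ∧ ρ i ≠ -1)
    (hβ : ∀ i, β i ^ 2 = ρ i ^ 2 - 1) (hbdef : ∀ i, b i = ρ i + β i)
    (hbinj : Function.Injective b) (hbInv : ∀ i j, b i ≠ (b j)⁻¹)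
    (n : ℕ) (hn : 1 ≤ n) (l : ℕ) (hl : l ≤ g)
    (h1 : (fun i => b i ^ (2 * n)) ∈ closT (Wn b l))
    (h2 : (fun i => b i ^ (2 * n)) ∉ Wn b l) :
    ∃ j : Fin g, (fun i => b (skip j i) ^ (2 * (n - 1))) ∈
      closT (W (fun i => b (skip j i)) ((l : ℤ) - 2)) := by
  have hb0 : ∀ i, b i ≠ 0 := fun i h => by
    have : b i * (ρ i - β i) = 1 := by rw [hbdef]; linear_combination -hβ i
    simp [h] at this
  have hx0 : ∀ i, b i ^ (2 * n) ≠ 0 := fun i => pow_ne_zero _ (hb0 i)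
  let Φ : (Fin l → OnePoint ℂ) → Fin g → ℂ := fun z i => ∏ k, rr (b i) (z k)
  let S : Set (Fin l → OnePoint ℂ) := {z | ∀ k, Allowed b (z k)}
  have hW : Wn b l ⊆ Φ '' S := fun x ⟨z, hz, hxz⟩ => ⟨z, hz, (funext hxz).symm⟩
  have hcl := closure_mono hW h1.1
  rw [mem_closure_iff_clusterPt, ClusterPt, ← map_principal, inf_comm,
    ← Filter.push_pull, map_neBot_iff] at hcl
  obtain ⟨U, hU⟩ := Ultrafilter.exists_le (f := 𝓟 S ⊓ comap Φ (𝓝 fun i => b i ^ (2 * n)))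
  have hUS : ∀ᶠ z in (U : Filter _), z ∈ S := hU.trans inf_le_left (mem_principal_self S)
  have hΦ : Tendsto Φ U (𝓝 fun i => b i ^ (2 * n)) :=
    tendsto_iff_comap.2 (hU.trans inf_le_right)
  rw [tendsto_pi_nhds] at hΦ
  obtain ⟨ζ, -, hζ⟩ := isCompact_univ.ultrafilter_le_nhds U (by simp)
  obtain ⟨j, k₁, k₂, hk₁, hk₂⟩ : ∃ j k₁ k₂, ζ k₁ = (b j : OnePoint ℂ) ∧
      ζ k₂ = (((b j)⁻¹ : ℂ) : OnePoint ℂ) := by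
    by_contra! hne
    have hzero : ∀ i k, ζ k ≠ (b i : OnePoint ℂ) := fun i k hk =>
      let ⟨k', hk'⟩ := exists_eq_pole hζ (hx0 i) (hΦ i) hk
      hne i k k' hk hk'
    have hpole : ∀ i k, ζ k ≠ (((b i)⁻¹ : ℂ) : OnePoint ℂ) := fun i k hk => by
      have hlim : Tendsto (fun z : Fin l → OnePoint ℂ => ∏ k, rr (b i)⁻¹ (z k)) U
          (𝓝 (b i ^ (2 * n))⁻¹) := ((hΦ i).inv₀ (hx0 i)).congr fun z =>
        (Finset.prod_inv_distrib _).symm.trans (Finset.prod_congr rfl fun k _ => (rr_inv _ _).symm)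
      obtain ⟨k', hk'⟩ := exists_eq_pole hζ (inv_ne_zero (hx0 i)) hlim hk
      rw [inv_inv] at hk'
      exact hzero i k' hk'
    exact h2 ⟨ζ, fun k i => ⟨hzero i k, hpole i k⟩, fun i => tendsto_nhds_unique (hΦ i)
      (tendsto_finsetProd Finset.univ fun k _ => tendsto_rr hζ (hpole i k))⟩
  have hk : k₁ ≠ k₂ := by
    rintro rfl
    exact hbInv j j (OnePoint.coe_injective (hk₁.symm.trans hk₂))
  refine ⟨j, ?_, fun i => pow_ne_zero _ (hb0 _)⟩
  let T : Finset (Fin l) := (Finset.univ.erase k₁).erase k₂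
  have hT : T.card = l - 2 := by
    simp [T, Finset.card_erase_of_mem, hk.symm, Nat.sub_sub]
  have hl2 : 2 ≤ l := by
    have := k₁.2
    have := k₂.2
    have := Fin.val_ne_of_ne hk
    omega
  let e : Fin (l - 2) ≃ T := (T.equivFinOfCardEq hT).symm
  have hsplit : ∀ f : Fin l → ℂ, ∏ k, f k = f k₁ * f k₂ * ∏ k, f (e k) := fun f => by
    rw [e.prod_comp (fun k : T => f k), Finset.prod_coe_sort T f, mul_assoc,
      Finset.mul_prod_erase _ f (by simp [hk.symm]), Finset.mul_prod_erase _ f (by simp)]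
  refine mem_closure_of_tendsto (b := (U : Filter (Fin l → OnePoint ℂ)))
    (f := fun z i => ∏ k, rr (b (skip j i)) (z (e k))) (tendsto_pi_nhds.2 fun i => ?_) ?_
  · have hne := skip_ne j i
    generalize skip j i = i' at hne ⊢
    have hjb : b j ≠ b i' := fun h => hne (hbinj h).symm
    have hmul := rr_mul_rr_inv (hb0 j) (hb0 i') hjb (hbInv j i')
    have hpair : Tendsto (fun z : Fin l → OnePoint ℂ => rr (b i') (z k₁) * rr (b i') (z k₂)) U
        (𝓝 (b i' ^ 2)) := by
      rw [← hmul]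
      have t₁ := tendsto_rr hζ (c := b i') (k := k₁) fun h =>
        hbInv j i' (OnePoint.coe_injective (hk₁.symm.trans h))
      have t₂ := tendsto_rr hζ (c := b i') (k := k₂) fun h =>
        hjb (inv_injective (OnePoint.coe_injective (hk₂.symm.trans h)))
      rw [hk₁] at t₁
      rw [hk₂] at t₂
      exact t₁.mul t₂
    have hlim := (hΦ i').div hpair (pow_ne_zero 2 (hb0 i'))
    have hpow : b i' ^ (2 * n) / b i' ^ 2 = b i' ^ (2 * (n - 1)) := by
      rw [div_eq_iff (pow_ne_zero 2 (hb0 i')), ← pow_add]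
      congr 1
      omega
    rw [hpow] at hlim
    refine hlim.congr' ?_
    filter_upwards [hUS] with z hz
    have hz0 := fun k => rr_ne_zero (hz k i').1 (hz k i').2
    simp only [Pi.div_apply, Φ, hsplit fun k => rr (b i') (z k)]
    exact mul_div_cancel_left₀ _ (mul_ne_zero (hz0 k₁) (hz0 k₂))
  · filter_upwards [hUS] with z hz
    exact ⟨l - 2, by omega, fun k => z (e k), fun k i => hz _ _, fun i => rfl⟩
end

section
/- Let n ≥ 1 and 0 ≤ l ≤ g. Then the following two conditions hold simultaneously: (a) δ^n lies in the closure of W_l but not in the closure of W_{l−1}, and δ^{n−1} does not lie in the closure of W_{l−1}; if and only if (b) there exists a convergent (p, q) of f with deg p = n and ord(p − q f) = deg q + d − l. -/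
/-- The element `t` of `ℂ((t⁻¹))`: we model `ℂ((t⁻¹))` as the field `LaurentSeries ℂ` of formal
Laurent series in the variable `X = t⁻¹`, so `t` is the inverse of the variable,
i.e. the Hahn series `X⁻¹`. -/
noncomputable def tK : LaurentSeries ℂ := HahnSeries.single (-1 : ℤ) 1

/-- The embedding `ℂ[t] → ℂ((t⁻¹))`, sending a polynomial `p` to `p(t)`. -/
noncomputable def emb (p : Polynomial ℂ) : LaurentSeries ℂ := Polynomial.aeval tK p

/-- `ord(h)` = the order of vanishing at infinity: for `h = Σ_{n ≤ n₀} c_n tⁿ` nonzero it is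
`−max{n : c_n ≠ 0}`, i.e. the Hahn-series order (least exponent of `t⁻¹` in the support),
and `ord 0 = ⊤`. -/
noncomputable def ordE (h : LaurentSeries ℂ) : WithTop ℤ :=
  letI := Classical.propDecidable (h = 0)
  if h = 0 then ⊤ else (h.order : WithTop ℤ)

/-- `(p, q)` is a convergent of `f`: `p, q` are coprime polynomials, `q ≠ 0`, and
`ord(p − q f) ≥ deg q + 1`. -/
def IsConvergent (f : LaurentSeries ℂ) (p q : Polynomial ℂ) : Prop :=
  q ≠ 0 ∧ IsCoprime p q ∧
    (((q.natDegree : ℤ) + 1 : ℤ) : WithTop ℤ) ≤ ordE (emb p - emb q * f)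

open Polynomial Filter Topology

/-- A point whose coordinates are the ratios `P(b_i) / P(b_i⁻¹)` lies in `W_m` when `deg P ≤ m`. -/
lemma eval_div_eval_mem_Wn {g : ℕ} {b : Fin g → ℂ} (m : ℕ) (P : ℂ[X]) (hm : P.natDegree ≤ m)
    (h₁ : ∀ i, P.eval (b i) ≠ 0) (h₂ : ∀ i, P.eval (b i)⁻¹ ≠ 0) :
    (fun i => P.eval (b i) / P.eval (b i)⁻¹) ∈ Wn b m := by
  induction m generalizing P with
  | zero =>
    refine ⟨Fin.elim0, fun j => j.elim0, fun i => ?_⟩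
    rw [eq_C_of_natDegree_le_zero hm] at h₁ ⊢
    simpa using div_self (by simpa using h₁ i)
  | succ m ih =>
    by_cases hP : P.natDegree ≤ m
    · obtain ⟨z, hz, hx⟩ := ih P hP h₁ h₂
      refine ⟨Fin.cons none z, fun j => ?_, fun i => ?_⟩
      · refine Fin.cases ?_ (fun j => ?_) j
        · intro i; simp
        · simpa using hz j
      · simpa [Fin.prod_univ_succ, rr] using hx i
    · have hdeg : P.natDegree = m + 1 := by omega
      obtain ⟨w, hw⟩ := IsAlgClosed.exists_root P (by
        intro h
        rw [natDegree_eq_of_degree_eq_some h] at hdeg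
        simp at hdeg)
      obtain ⟨Q, rfl⟩ := dvd_iff_isRoot.mpr hw
      have hQ0 : Q ≠ 0 := by rintro rfl; simp at hdeg
      have hQ : Q.natDegree ≤ m := by
        rw [natDegree_mul (X_sub_C_ne_zero w) hQ0, natDegree_X_sub_C] at hdeg
        omega
      simp only [eval_mul, eval_sub, eval_X, eval_C, mul_ne_zero_iff] at h₁ h₂
      obtain ⟨z, hz, hx⟩ := ih Q hQ (fun i => (h₁ i).2) (fun i => (h₂ i).2)
      refine ⟨Fin.cons (some w) z, fun j => ?_, fun i => ?_⟩
      · refine Fin.cases ?_ (fun j => ?_) j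
        · intro i
          have h1 := (h₁ i).1
          have h2 := (h₂ i).1
          simp only [Fin.cons_zero, ne_eq, Option.some.injEq]
          exact ⟨fun h => h1 (by rw [h, sub_self]), fun h => h2 (by rw [h, sub_self])⟩
        · simpa using hz j
      · have hx := hx i
        simp only [Fin.prod_univ_succ, Fin.cons_zero, Fin.cons_succ, ← hx, eval_mul, eval_sub, eval_X,
          eval_C]
        simp only [rr, Option.elim]
        rw [mul_div_mul_comm, ← neg_sub w, ← neg_sub w, neg_div_neg_eq]

/-- Every point of `W_m` is given by the ratios `P(b_i) / P(b_i⁻¹)` for some `P` of degree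
at most `m`. -/
lemma exists_poly_of_mem_Wn {g : ℕ} {b : Fin g → ℂ} {m : ℕ} {x : Fin g → ℂ} (hx : x ∈ Wn b m) :
    ∃ P : ℂ[X], P ≠ 0 ∧ P.degree < ((m + 1 : ℕ) : WithBot ℕ) ∧
      ∀ i, P.eval (b i) = x i * P.eval (b i)⁻¹ := by
  obtain ⟨z, hz, hx⟩ := hx
  let F : Option ℂ → ℂ[X] := fun w => w.elim 1 (fun w => X - C w)
  have hF0 : ∀ w, F w ≠ 0 := by
    rintro (_ | w)
    · exact one_ne_zero
    · exact X_sub_C_ne_zero w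
  have hF1 : ∀ w, (F w).natDegree ≤ 1 := by
    rintro (_ | w)
    · simp [F]
    · simp [F]
  have hP0 : ∏ j, F (z j) ≠ 0 := Finset.prod_ne_zero_iff.mpr fun j _ => hF0 _
  refine ⟨∏ j, F (z j), hP0, ?_, fun i => ?_⟩
  · rw [degree_eq_natDegree hP0, Nat.cast_lt, Nat.lt_succ_iff]
    refine (natDegree_prod_le _ _).trans ((Finset.sum_le_sum fun j _ => hF1 (z j)).trans ?_)
    simp
  · rw [hx i, eval_prod, eval_prod, ← Finset.prod_mul_distrib]
    refine Finset.prod_congr rfl fun j _ => ?_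
    have := hz j i
    rcases h : z j with _ | w
    · simp [F, rr]
    · have h2 : w - (b i)⁻¹ ≠ 0 := by
        have := this.2
        rw [h] at this
        exact sub_ne_zero.mpr fun h' => this (by rw [h'])
      simp only [F, rr, Option.elim, eval_sub, eval_X, eval_C]
      rw [← neg_sub w (b i)⁻¹, mul_neg, div_mul_cancel₀ _ h2, neg_sub]

/-- The set of `x` admitting a nonzero `P` of degree `< k` with `P(b_i) = x_i P(c_i)` is closed. -/
lemma isClosed_exists_poly {g : ℕ} (b c : Fin g → ℂ) (k : ℕ) :
    IsClosed {x : Fin g → ℂ | ∃ P : ℂ[X], P ≠ 0 ∧ P.degree < k ∧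
      ∀ i, P.eval (b i) = x i * P.eval (c i)} := by
  have hopen := isOpen_setOfPred_linearIndependent (𝕜 := ℂ) (E := Fin g → ℂ) (ι := Fin k)
  let v : (Fin g → ℂ) → Fin k → Fin g → ℂ :=
    fun x j i => b i ^ (j : ℕ) - x i * c i ^ (j : ℕ)
  have hv : Continuous v := by fun_prop
  convert (hopen.preimage hv).isClosed_compl using 1
  ext x
  simp only [Set.mem_ofPred_eq, Set.mem_compl_iff, Set.mem_preimage,
    Fintype.not_linearIndependent_iff]
  constructor
  · rintro ⟨P, hP0, hdeg, hP⟩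
    refine ⟨fun j => P.coeff j, ?_, ?_⟩
    · ext i
      have hP := hP i
      have hn : P.natDegree < k := (natDegree_lt_iff_degree_lt hP0).mpr hdeg
      rw [eval_eq_sum_range' hn, eval_eq_sum_range' hn, Finset.sum_range, Finset.sum_range] at hP
      simp only [Finset.sum_apply, Pi.smul_apply, smul_eq_mul, Pi.zero_apply, v, mul_sub,
        Finset.sum_sub_distrib, hP, Finset.mul_sum]
      rw [sub_eq_zero]
      exact Finset.sum_congr rfl fun j _ => by ring
    · by_contra! h
      apply hP0
      ext j
      by_cases hj : j < k
      · simpa using h ⟨j, hj⟩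
      · exact coeff_eq_zero_of_degree_lt (hdeg.trans_le (by exact_mod_cast not_lt.mp hj))
  · rintro ⟨a, ha, j, hj⟩
    refine ⟨∑ j : Fin k, C (a j) * X ^ (j : ℕ), ?_, ?_, fun i => ?_⟩
    · intro h
      apply hj
      have := congrArg (fun p => coeff p j) h
      simpa [finsetSum_coeff, coeff_C_mul, coeff_X_pow, Fin.val_inj] using this
    · rw [← mem_degreeLT]
      refine Submodule.sum_mem _ fun j _ => mem_degreeLT.mpr ?_
      exact (degree_C_mul_X_pow_le _ _).trans_lt (by exact_mod_cast j.2)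
    · have := congrFun ha i
      simp only [Finset.sum_apply, Pi.smul_apply, smul_eq_mul, Pi.zero_apply, v, mul_sub,
        Finset.sum_sub_distrib, sub_eq_zero] at this
      simp only [eval_finsetSum, eval_mul, eval_C, eval_pow, eval_X, this, Finset.mul_sum]
      exact Finset.sum_congr rfl fun j _ => by ring

/-- The nonzero solutions `P` of `P(b_i) = x_i P(b_i⁻¹)` of degree at most `m` witness that `x` lies
in the closure of `W_m`. -/
lemma mem_closure_Wn {g : ℕ} {b : Fin g → ℂ} (hbinj : Function.Injective b)
    (hbInv : ∀ i j, b i ≠ (b j)⁻¹) {m : ℕ} {x : Fin g → ℂ} (hx : ∀ i, x i ≠ 0) {P : ℂ[X]}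
    (hP0 : P ≠ 0) (hdeg : P.degree < ((m + 1 : ℕ) : WithBot ℕ))
    (hP : ∀ i, P.eval (b i) = x i * P.eval (b i)⁻¹) : x ∈ closure (Wn b m) := by
  classical
  let S : Finset (Fin g × Bool) := Finset.univ.filter fun ib => P.eval (b ib.1) = 0
  let v : Fin g × Bool → ℂ := fun ib => cond ib.2 (b ib.1) (b ib.1)⁻¹
  let r : Fin g × Bool → ℂ := fun ib => cond ib.2 (x ib.1) 1
  have hv : Function.Injective v := by
    rintro ⟨i, _ | _⟩ ⟨j, _ | _⟩ h
    · simpa [v, hbinj.eq_iff] using h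
    · exact absurd (by simpa [v] using h.symm) (hbInv j i)
    · exact absurd (by simpa [v] using h) (hbInv i j)
    · simpa [v, hbinj.eq_iff] using h
  have hinv : ∀ i, P.eval (b i) = 0 ↔ P.eval (b i)⁻¹ = 0 := fun i => by
    rw [hP i, mul_eq_zero, or_iff_right (hx i)]
  have hcard : S.card < m + 1 := by
    by_contra! hle
    refine hP0 (eq_zero_of_degree_lt_of_eval_index_eq_zero S hv.injOn
      (hdeg.trans_le (by exact_mod_cast hle)) ?_)
    rintro ⟨i, _ | _⟩ hi
    · simpa [v] using (hinv i).mp (by simpa [S] using hi)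
    · simpa [v, S] using hi
  let R : ℂ[X] := Lagrange.interpolate S v r
  have hRdeg : R.degree < ((m + 1 : ℕ) : WithBot ℕ) :=
    (Lagrange.degree_interpolate_lt r hv.injOn).trans (by exact_mod_cast hcard)
  have hR₁ : ∀ i, P.eval (b i) = 0 → R.eval (b i) = x i := fun i hi => 
    Lagrange.eval_interpolate_at_node r (s := S) (v := v) hv.injOn
      (i := (i, true)) (by simpa [S] using hi)
  have hR₂ : ∀ i, P.eval (b i) = 0 → R.eval (b i)⁻¹ = 1 := fun i hi => 
    Lagrange.eval_interpolate_at_node r (s := S) (v := v) hv.injOn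
      (i := (i, false)) (by simpa [S] using hi)
  have hlim : ∀ w : ℂ, Tendsto (fun ε : ℂ => (P + C ε * R).eval w) (𝓝[≠] 0) (𝓝 (P.eval w)) := by
    intro w
    have : Continuous fun ε : ℂ => (P + C ε * R).eval w := by
      simp only [eval_add, eval_mul, eval_C]
      fun_prop
    simpa using (this.tendsto 0).mono_left nhdsWithin_le_nhds
  have hne : ∀ᶠ ε : ℂ in 𝓝[≠] 0, ε ≠ 0 := eventually_mem_nhdsWithin
  have hnv : ∀ᶠ ε : ℂ in 𝓝[≠] 0, ∀ i,
      (P + C ε * R).eval (b i) ≠ 0 ∧ (P + C ε * R).eval (b i)⁻¹ ≠ 0 := by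
    rw [eventually_all]
    intro i
    by_cases hi : P.eval (b i) = 0
    · filter_upwards [hne] with ε hε
      simp [hi, (hinv i).mp hi, hR₁ i hi, hR₂ i hi, hε, hx i]
    · exact ((hlim _).eventually_ne hi).and
        ((hlim _).eventually_ne fun h => hi ((hinv i).mpr h))
  refine mem_closure_of_tendsto (b := 𝓝[≠] (0 : ℂ))
    (f := fun ε i => (P + C ε * R).eval (b i) / (P + C ε * R).eval (b i)⁻¹) ?_ ?_
  · rw [tendsto_pi_nhds]
    intro i
    by_cases hi : P.eval (b i) = 0
    · refine tendsto_const_nhds.congr' ?_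
      filter_upwards [hne] with ε hε
      simp [hi, (hinv i).mp hi, hR₁ i hi, hR₂ i hi, hε]
    · have h2 : P.eval (b i)⁻¹ ≠ 0 := fun h => hi ((hinv i).mpr h)
      have := (hlim (b i)).div (hlim (b i)⁻¹) h2
      rwa [hP i, mul_div_cancel_right₀ _ h2] at this
  · filter_upwards [hnv] with ε hε
    refine eval_div_eval_mem_Wn m _ ?_ (fun i => (hε i).1) (fun i => (hε i).2)
    have hlt : (P + C ε * R).degree < ((m + 1 : ℕ) : WithBot ℕ) := by
      rw [← mem_degreeLT] at *
      rw [← smul_eq_C_mul]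
      exact add_mem hdeg (Submodule.smul_mem _ ε hRdeg)
    exact natDegree_le_iff_coeff_eq_zero.mpr fun N hN =>
      coeff_eq_zero_of_degree_lt (hlt.trans_le (by exact_mod_cast hN))

/-- The closure of `W_{k-1}` in the torus consists of the `x` for which `P(b_i) = x_i P(b_i⁻¹)` has a
nonzero solution `P` of degree less than `k`. -/
lemma mem_closT_W_iff {g : ℕ} {b : Fin g → ℂ} (hbinj : Function.Injective b)
    (hbInv : ∀ i j, b i ≠ (b j)⁻¹) (k : ℕ) {x : Fin g → ℂ} (hx : ∀ i, x i ≠ 0) :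
    x ∈ closT (W b ((k : ℤ) - 1)) ↔
      ∃ P : ℂ[X], P ≠ 0 ∧ P.degree < k ∧ ∀ i, P.eval (b i) = x i * P.eval (b i)⁻¹ := by
  constructor
  · rintro ⟨hcl, -⟩
    refine closure_minimal ?_ (isClosed_exists_poly b (fun i => (b i)⁻¹) k) hcl
    rintro y ⟨m, hm, hy⟩
    obtain rfl : k = m + 1 := by omega
    exact exists_poly_of_mem_Wn hy
  · rintro ⟨P, hP0, hdeg, hP⟩
    cases k with
    | zero => simp_all
    | succ m =>
      refine ⟨closure_mono ?_ (mem_closure_Wn hbinj hbInv hx hP0 hdeg hP), hx⟩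
      exact fun y hy => ⟨m, by push_cast; ring, hy⟩

/-- With `z = t + s` and `s² = t² - 1`, so that `z + z⁻¹ = 2t`, the expression `zⁿ p(t)` is a
polynomial in `z` if `deg p ≤ n`. -/
lemma exists_aeval_add_eq (n : ℕ) (p : ℂ[X]) (hp : p.natDegree ≤ n) :
    ∃ S : ℂ[X], ∀ (A : Type) [CommRing A] [Algebra ℂ A] (t s : A), s ^ 2 = t ^ 2 - 1 →
      aeval (t + s) S = (t + s) ^ n * aeval t p := by
  induction n generalizing p with
  | zero =>
    refine ⟨p, fun A _ _ t s _ => ?_⟩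
    rw [eq_C_of_natDegree_le_zero hp]
    simp
  | succ n ih =>
    obtain ⟨S, hS⟩ := ih p.divX (by rw [natDegree_divX_eq_natDegree_tsub_one]; omega)
    refine ⟨C (p.coeff 0) * X ^ (n + 1) + C (1 / 2) * (X ^ 2 + 1) * S, fun A _ _ t s h => ?_⟩
    have hp : aeval t p = t * aeval t p.divX + algebraMap ℂ A (p.coeff 0) := by
      conv_lhs => rw [← X_mul_divX_add p]
      rw [map_add, map_mul, aeval_X, aeval_C]
    have h2 : algebraMap ℂ A (1 / 2) * 2 = 1 := by
      rw [← map_ofNat (algebraMap ℂ A) 2, ← map_mul]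
      norm_num
    have hz : algebraMap ℂ A (1 / 2) * ((t + s) ^ 2 + 1) = (t + s) * t := by
      linear_combination ((t + s) * t) * h2 + algebraMap ℂ A (1 / 2) * h
    rw [hp]
    simp only [map_add, map_mul, aeval_C, map_pow, aeval_X, map_one, hS A t s h, hz]
    ring

/-- Every `p(t) - q(t) s` with `deg p ≤ n` and `deg q < n` is `z⁻ⁿ P(z)` for a polynomial `P`. -/
lemma exists_poly_of_pair (n : ℕ) (p q : ℂ[X]) (hp : p.natDegree ≤ n) (hq : q.degree < n) :
    ∃ P : ℂ[X], ∀ (A : Type) [CommRing A] [Algebra ℂ A] (t s : A), s ^ 2 = t ^ 2 - 1 →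
      aeval (t + s) P = (t + s) ^ n * (aeval t p - aeval t q * s) := by
  obtain ⟨S, hS⟩ := exists_aeval_add_eq n p hp
  by_cases hq0 : q = 0
  · exact ⟨S, fun A _ _ t s h => by simp [hS A t s h, hq0]⟩
  have hq' : q.natDegree < n := (natDegree_lt_iff_degree_lt hq0).mpr hq
  obtain ⟨m, rfl⟩ : ∃ m, n = m + 1 := ⟨n - 1, by omega⟩
  obtain ⟨R, hR⟩ := exists_aeval_add_eq m q (by omega)
  refine ⟨S - C (1 / 2) * (X ^ 2 - 1) * R, fun A _ _ t s h => ?_⟩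
  have h2 : algebraMap ℂ A (1 / 2) * 2 = 1 := by
    rw [← map_ofNat (algebraMap ℂ A) 2, ← map_mul]
    norm_num
  have hz : algebraMap ℂ A (1 / 2) * ((t + s) ^ 2 - 1) = (t + s) * s := by
    linear_combination ((t + s) * s) * h2 - algebraMap ℂ A (1 / 2) * h
  simp only [map_sub, map_mul, aeval_C, map_pow, aeval_X, map_one, hS A t s h, hR A t s h, hz]
  ring

/-- `(t + s)ʲ = p(t) + q(t) s` with `deg p ≤ j` and `deg q < j` whenever `s² = t² - 1`. -/
lemma exists_pair_pow (j : ℕ) :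
    ∃ p q : ℂ[X], p.degree < ((j + 1 : ℕ) : WithBot ℕ) ∧ q.degree < j ∧
      ∀ (A : Type) [CommRing A] [Algebra ℂ A] (t s : A), s ^ 2 = t ^ 2 - 1 →
        (t + s) ^ j = aeval t p + aeval t q * s := by
  induction j with
  | zero => exact ⟨1, 0, by simp, by simp, fun A _ _ t s _ => by simp⟩
  | succ j ih =>
    obtain ⟨p, q, hp, hq, h⟩ := ih
    refine ⟨p * X + q * (X ^ 2 - 1), p + q * X, ?_, ?_, fun A _ _ t s hs => ?_⟩
    · rw [degree_lt_iff_coeff_zero] at *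
      intro m hm
      obtain ⟨m, rfl⟩ : ∃ k, m = k + 2 := ⟨m - 2, by omega⟩
      rw [mul_sub, mul_one, coeff_add, coeff_sub, coeff_mul_X, coeff_mul_X_pow, hp _ (by omega),
        hq _ (by omega), hq _ (by omega)]
      simp
    · rw [degree_lt_iff_coeff_zero] at *
      intro m hm
      obtain ⟨m, rfl⟩ : ∃ k, m = k + 1 := ⟨m - 1, by omega⟩
      rw [coeff_add, coeff_mul_X, hp _ (by omega), hq _ (by omega)]
      simp
    · rw [pow_succ, h A t s hs]
      simp only [map_add, map_mul, map_sub, map_pow, aeval_X, map_one]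
      linear_combination (aeval t q) * hs

/-- Every `z⁻ⁿ P(z)` with `deg P ≤ 2n` is `p(t) - q(t) s` with `deg p ≤ n` and `deg q < n`. -/
lemma exists_pair_of_poly (n : ℕ) (P : ℂ[X]) (hP : P.natDegree ≤ 2 * n) :
    ∃ p q : ℂ[X], p.natDegree ≤ n ∧ q.degree < n ∧
      ∀ (A : Type) [CommRing A] [Algebra ℂ A] (t s : A), s ^ 2 = t ^ 2 - 1 →
        aeval (t + s) P = (t + s) ^ n * (aeval t p - aeval t q * s) := by
  have key : ∀ k : ℕ, k ≤ 2 * n → ∃ p q : ℂ[X], p.degree < ((n + 1 : ℕ) : WithBot ℕ) ∧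
      q.degree < n ∧ ∀ (A : Type) [CommRing A] [Algebra ℂ A] (t s : A), s ^ 2 = t ^ 2 - 1 →
        (t + s) ^ k = (t + s) ^ n * (aeval t p - aeval t q * s) := by
    intro k hk
    rcases le_total n k with h | h
    · obtain ⟨j, rfl⟩ := Nat.exists_eq_add_of_le h
      obtain ⟨p, q, hp, hq, hpq⟩ := exists_pair_pow j
      refine ⟨p, -q, hp.trans_le (by norm_cast; omega),
        by rw [degree_neg]; exact hq.trans_le (by norm_cast; omega), fun A _ _ t s hs => ?_⟩
      rw [pow_add, hpq A t s hs, map_neg]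
      ring
    · obtain ⟨j, rfl⟩ := Nat.exists_eq_add_of_le h
      obtain ⟨p, q, hp, hq, hpq⟩ := exists_pair_pow j
      refine ⟨p, q, hp.trans_le (by norm_cast; omega), hq.trans_le (by norm_cast; omega),
        fun A _ _ t s hs => ?_⟩
      have h1 : (t + s) ^ j * (t + -s) ^ j = 1 := by
        rw [← mul_pow, show (t + s) * (t + -s) = 1 by linear_combination -hs, one_pow]
      have h2 := hpq A t (-s) (by rw [neg_sq, hs])
      rw [pow_add, show aeval t p - aeval t q * s = (t + -s) ^ j by rw [h2]; ring, mul_assoc, h1,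
        mul_one]
  choose! p q hp hq hpq using key
  have hle : ∀ k ∈ Finset.range (2 * n + 1), k ≤ 2 * n := fun k hk => by simpa using hk
  refine ⟨∑ k ∈ Finset.range (2 * n + 1), P.coeff k • p k,
    ∑ k ∈ Finset.range (2 * n + 1), P.coeff k • q k, ?_, ?_, fun A _ _ t s hs => ?_⟩
  · have : ∑ k ∈ Finset.range (2 * n + 1), P.coeff k • p k ∈ degreeLT ℂ (n + 1) :=
      Submodule.sum_mem _ fun k hk => Submodule.smul_mem _ _ (mem_degreeLT.mpr (hp k (hle k hk)))
    exact natDegree_le_iff_coeff_eq_zero.mpr fun N hN =>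
      coeff_eq_zero_of_degree_lt ((mem_degreeLT.mp this).trans_le (by exact_mod_cast hN))
  · exact mem_degreeLT.mp <| Submodule.sum_mem _ fun k hk =>
      Submodule.smul_mem _ _ (mem_degreeLT.mpr (hq k (hle k hk)))
  · rw [aeval_eq_sum_range' (Nat.lt_succ_of_le hP)]
    simp only [map_sum, map_smul, Finset.sum_mul, ← Finset.sum_sub_distrib, Finset.mul_sum]
    refine Finset.sum_congr rfl fun k hk => ?_
    rw [hpq k (hle k hk) A t s hs, smul_mul_assoc, ← smul_sub, mul_smul_comm]

lemma ordE_eq_orderTop (h : LaurentSeries ℂ) : ordE h = h.orderTop := by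
  unfold ordE
  split_ifs with h0
  · simp [h0]
  · exact HahnSeries.order_eq_orderTop_of_ne_zero h0

lemma algebraMap_laurentSeries (c : ℂ) :
    algebraMap ℂ (LaurentSeries ℂ) c = HahnSeries.single 0 c := by
  rw [HahnSeries.algebraMap_apply', PowerSeries.algebraMap_apply, Algebra.algebraMap_self,
    RingHom.id_apply, HahnSeries.ofPowerSeries_C, HahnSeries.C_apply]

/-- Substituting a series with a simple pole into `P` gives a series with a pole of order
`deg P`. -/
lemma orderTop_aeval {x : LaurentSeries ℂ} (hx : x.orderTop = ((-1 : ℤ) : WithTop ℤ)) {P : ℂ[X]}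
    (hP : P ≠ 0) : (aeval x P).orderTop = ((-(P.natDegree : ℤ) : ℤ) : WithTop ℤ) := by
  have hC : ∀ c : ℂ, (0 : WithTop ℤ) ≤ (algebraMap ℂ (LaurentSeries ℂ) c).orderTop := fun c => by
    rw [algebraMap_laurentSeries]
    exact HahnSeries.orderTop_single_le
  induction hn : P.natDegree generalizing P with
  | zero =>
    rw [eq_C_of_natDegree_eq_zero hn] at hP ⊢
    rw [aeval_C, algebraMap_laurentSeries, HahnSeries.orderTop_single (by simpa using hP)]
    simp
  | succ n ih =>
    have hd : P.divX.natDegree = n := by rw [natDegree_divX_eq_natDegree_tsub_one, hn]; rfl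
    have hd0 : P.divX ≠ 0 := by
      intro h
      rw [divX_eq_zero_iff] at h
      rw [h, natDegree_C] at hn
      omega
    have h1 : (x * aeval x P.divX).orderTop = ((-((n + 1 : ℕ) : ℤ) : ℤ) : WithTop ℤ) := by
      rw [HahnSeries.orderTop_mul, hx, ih hd0 hd, ← WithTop.coe_add]
      congr 1
      push_cast
      ring
    conv_lhs => rw [← X_mul_divX_add P]
    rw [map_add, map_mul, aeval_X, aeval_C, HahnSeries.orderTop_add_eq_left, h1]
    rw [h1]
    refine lt_of_lt_of_le ?_ (hC _)
    rw [← WithTop.coe_zero, WithTop.coe_lt_coe]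
    omega

lemma orderTop_tK : tK.orderTop = ((-1 : ℤ) : WithTop ℤ) :=
  HahnSeries.orderTop_single one_ne_zero

lemma orderTop_emb {p : ℂ[X]} (hp : p ≠ 0) :
    (emb p).orderTop = ((-(p.natDegree : ℤ) : ℤ) : WithTop ℤ) :=
  orderTop_aeval orderTop_tK hp

lemma emb_ne_zero {p : ℂ[X]} (hp : p ≠ 0) : emb p ≠ 0 := by
  rw [← HahnSeries.orderTop_ne_top, orderTop_emb hp]
  exact WithTop.coe_ne_top

lemma coeff_emb (p : ℂ[X]) (k : ℕ) : (emb p).coeff (-(k : ℤ)) = p.coeff k := by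
  induction p using Polynomial.induction_on' with
  | add p q hp hq =>
    rw [emb, map_add, HahnSeries.coeff_add, coeff_add, ← hp, ← hq]
    rfl
  | monomial m a =>
    rw [emb, aeval_monomial, algebraMap_laurentSeries, tK, HahnSeries.single_pow, one_pow,
      HahnSeries.single_mul_single, mul_one, HahnSeries.coeff_single, coeff_monomial]
    simp [eq_comm]

/-- A square root of `D = (t² - 1) D₁²` with leading term `t^(g + 1)` is `s D₁(t)` for a square root
`s` of `t² - 1` such that `t + s` has a simple pole. -/
lemma exists_sqrt_factor {D₁ : ℂ[X]} {f : LaurentSeries ℂ} (hmonic : D₁.Monic)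
    (hf2 : f ^ 2 = emb ((X ^ 2 - 1) * D₁ ^ 2))
    (hlead : f.coeff (-((D₁.natDegree + 1 : ℕ) : ℤ)) = 1) :
    ∃ s : LaurentSeries ℂ, s ^ 2 = tK ^ 2 - 1 ∧ f = s * emb D₁ ∧
      s.orderTop = ((-1 : ℤ) : WithTop ℤ) ∧ (tK + s).orderTop = ((-1 : ℤ) : WithTop ℤ) := by
  have hD0 : emb D₁ ≠ 0 := emb_ne_zero hmonic.ne_zero
  have hs2 : (f / emb D₁) ^ 2 = tK ^ 2 - 1 := by
    rw [div_pow, hf2, div_eq_iff (pow_ne_zero 2 hD0)]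
    simp [emb]
  have hfs : f = f / emb D₁ * emb D₁ := (div_mul_cancel₀ f hD0).symm
  generalize f / emb D₁ = s at hs2 hfs
  have hprod : (tK + s) * (tK - s) = 1 := by linear_combination -hs2
  have hz0 : tK + s ≠ 0 := left_ne_zero_of_mul_eq_one hprod
  have hw0 : tK - s ≠ 0 := right_ne_zero_of_mul_eq_one hprod
  have hsum : (tK + s).order + (tK - s).order = 0 := by
    rw [← HahnSeries.order_mul hz0 hw0, hprod, HahnSeries.order_one]
  have ht2 : (2 : LaurentSeries ℂ) * tK = emb (C 2 * X) := by
    simp only [emb, map_mul, aeval_X, map_ofNat]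
  have hord2 : ((2 : LaurentSeries ℂ) * tK).orderTop = ((-1 : ℤ) : WithTop ℤ) := by
    rw [ht2, orderTop_emb (by simp), natDegree_C_mul_X _ two_ne_zero]
    rfl
  have hs1 : s.orderTop = ((-1 : ℤ) : WithTop ℤ) := by
    have h1 : (X ^ 2 - C 1 : ℂ[X]) ≠ 0 := X_pow_sub_C_ne_zero two_pos 1
    have h2 : s ^ 2 = emb (X ^ 2 - C 1) := by simp [emb, hs2]
    have hs0 : s ≠ 0 := by
      rintro rfl
      exact emb_ne_zero h1 (by rw [← h2]; simp)
    have h3 := orderTop_emb h1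
    rw [← h2, natDegree_X_pow_sub_C,
      ← HahnSeries.order_eq_orderTop_of_ne_zero (pow_ne_zero 2 hs0), WithTop.coe_inj,
      HahnSeries.order_pow, nsmul_eq_mul] at h3
    rw [← HahnSeries.order_eq_orderTop_of_ne_zero hs0, WithTop.coe_inj]
    push_cast at h3
    linarith
  refine ⟨s, hs2, hfs, hs1, ?_⟩
  rcases lt_trichotomy (tK + s).order (tK - s).order with h | h | h
  · have := HahnSeries.orderTop_add_eq_left (x := tK + s) (y := tK - s) (by
      rwa [← HahnSeries.order_eq_orderTop_of_ne_zero hz0,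
        ← HahnSeries.order_eq_orderTop_of_ne_zero hw0, WithTop.coe_lt_coe])
    rw [← this, ← hord2]
    congr 1
    ring
  · have h0 : (tK + s).order = 0 := by omega
    have := HahnSeries.min_orderTop_le_orderTop_add (x := tK + s) (y := tK - s)
    rw [show tK + s + (tK - s) = 2 * tK by ring, hord2,
      ← HahnSeries.order_eq_orderTop_of_ne_zero hz0,
      ← HahnSeries.order_eq_orderTop_of_ne_zero hw0, ← h, h0, min_self, WithTop.coe_le_coe] at this
    omega
  · exfalso
    have hlt : (0 : ℤ) < (tK + s).order := by omega
    have hzD : (((-((D₁.natDegree + 1 : ℕ) : ℤ) : ℤ)) : WithTop ℤ) <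
        ((tK + s) * emb D₁).orderTop := by
      rw [HahnSeries.orderTop_mul, orderTop_emb hmonic.ne_zero,
        ← HahnSeries.order_eq_orderTop_of_ne_zero hz0, ← WithTop.coe_add, WithTop.coe_lt_coe]
      push_cast
      omega
    have hf : f = (tK + s) * emb D₁ - emb (X * D₁) := by
      rw [hfs]
      simp only [emb, map_mul, aeval_X]
      ring
    rw [hf, HahnSeries.coeff_sub, HahnSeries.coeff_eq_zero_of_lt_orderTop hzD, coeff_emb,
      coeff_X_mul, hmonic.coeff_natDegree] at hlead
    norm_num at hlead

lemma degree_mul_monic_lt_iff {D₁ q : ℂ[X]} (hmonic : D₁.Monic) (hq : q ≠ 0) (m : ℕ) :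
    (q * D₁).degree < m ↔ q.natDegree + D₁.natDegree < m := by
  rw [← natDegree_lt_iff_degree_lt (mul_ne_zero hq hmonic.ne_zero),
    natDegree_mul hq hmonic.ne_zero]

/-- A relation `P(z) = zᵐ h` determines the order of `h`. -/
lemma order_eq_of_aeval_eq {z h : LaurentSeries ℂ} (hz : z.orderTop = ((-1 : ℤ) : WithTop ℤ))
    {P : ℂ[X]} {m : ℕ} (hP : aeval z P = z ^ m * h) (hh : h ≠ 0) :
    P ≠ 0 ∧ h.order = (m : ℤ) - P.natDegree := by
  have hz0 : z ≠ 0 := by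
    rw [← HahnSeries.orderTop_ne_top, hz]
    exact WithTop.coe_ne_top
  have hP0 : P ≠ 0 := by
    rintro rfl
    rw [map_zero] at hP
    exact mul_ne_zero (pow_ne_zero m hz0) hh hP.symm
  rw [← HahnSeries.order_eq_orderTop_of_ne_zero hz0, WithTop.coe_inj] at hz
  have h1 := orderTop_aeval (by rw [← HahnSeries.order_eq_orderTop_of_ne_zero hz0, hz]) hP0
  rw [hP, ← HahnSeries.order_eq_orderTop_of_ne_zero (mul_ne_zero (pow_ne_zero m hz0) hh),
    WithTop.coe_inj, HahnSeries.order_mul (pow_ne_zero m hz0) hh, HahnSeries.order_pow, hz,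
    nsmul_eq_mul] at h1
  exact ⟨hP0, by linarith⟩

lemma orderTop_mul_emb_pos {h : LaurentSeries ℂ} {q : ℂ[X]} (hq : q ≠ 0 → h ≠ 0 →
    (q.natDegree : ℤ) < h.order) : (0 : WithTop ℤ) < (h * emb q).orderTop := by
  by_cases hq0 : q = 0
  · simp [hq0, emb]
  by_cases hh0 : h = 0
  · simp [hh0]
  rw [HahnSeries.orderTop_mul, orderTop_emb hq0, ← HahnSeries.order_eq_orderTop_of_ne_zero hh0,
    ← WithTop.coe_add, ← WithTop.coe_zero, WithTop.coe_lt_coe]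
  linarith [hq hq0 hh0]

lemma eq_zero_of_orderTop_emb_pos {p : ℂ[X]} (hp : (0 : WithTop ℤ) < (emb p).orderTop) :
    p = 0 := by
  by_contra h
  rw [orderTop_emb h, ← WithTop.coe_zero, WithTop.coe_lt_coe] at hp
  omega

/-- Best approximation: no pair with smaller degree bound approximates `f` as well as a coprime pair
`(p, q)` does, and none with the same degree bound does better. -/
lemma not_better_approximation {f : LaurentSeries ℂ} {p q p' q' : ℂ[X]} (hpq : IsCoprime p q)
    (hq : q ≠ 0) (hh : emb p - emb q * f ≠ 0)
    (hord : (q.natDegree : ℤ) < (emb p - emb q * f).order)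
    {m : ℕ} (hm : m ≤ p.natDegree) (hp' : p'.natDegree ≤ m)
    (hq' : q'.natDegree ≤ q.natDegree) (hh' : emb p' - emb q' * f ≠ 0)
    (hord' : (emb p - emb q * f).order ≤ (emb p' - emb q' * f).order)
    (hlt : m < p.natDegree ∨ (emb p - emb q * f).order < (emb p' - emb q' * f).order) : False := by
  have h0 : p * q' - p' * q = 0 := by
    apply eq_zero_of_orderTop_emb_pos
    have : emb (p * q' - p' * q) =
        (emb p - emb q * f) * emb q' - (emb p' - emb q' * f) * emb q := by
      simp only [emb, map_sub, map_mul]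
      ring
    rw [this]
    refine lt_of_lt_of_le (lt_min ?_ ?_) HahnSeries.min_orderTop_le_orderTop_sub
    · exact orderTop_mul_emb_pos fun _ _ => by omega
    · exact orderTop_mul_emb_pos fun _ _ => by omega
  obtain ⟨c, rfl⟩ : q ∣ q' := hpq.symm.dvd_of_dvd_mul_left ⟨p', by linear_combination h0⟩
  obtain rfl : p' = p * c := mul_right_cancel₀ hq (by linear_combination -h0)
  have hfac : emb (p * c) - emb (q * c) * f = emb c * (emb p - emb q * f) := by
    simp only [emb, map_mul]
    ring
  have hc : c ≠ 0 := by
    rintro rfl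
    simp [emb] at hh'
  have hco := orderTop_emb hc
  rw [← HahnSeries.order_eq_orderTop_of_ne_zero (emb_ne_zero hc), WithTop.coe_inj] at hco
  rw [hfac, HahnSeries.order_mul (emb_ne_zero hc) hh, hco] at hlt hord'
  have hp0 : p ≠ 0 := by
    rintro rfl
    simp only [natDegree_zero] at hm hlt
    omega
  rw [natDegree_mul hp0 hc] at hp'
  omega

/-- The data of the uniformisation of `y² = (t² - 1) D₁(t)²` by `z = t + s`, `s² = t² - 1`. -/
structure Uniformised {g : ℕ} (b ρ β : Fin g → ℂ) (D₁ : ℂ[X]) (f s : LaurentSeries ℂ) : Prop where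
  eq_add : ∀ i, b i = ρ i + β i
  sq : ∀ i, β i ^ 2 = ρ i ^ 2 - 1
  root_ne : ∀ i, ρ i ≠ 1 ∧ ρ i ≠ -1
  inj : Function.Injective ρ
  prod_eq : D₁ = ∏ i, (X - C (ρ i))
  sq_s : s ^ 2 = tK ^ 2 - 1
  eq_mul : f = s * emb D₁
  orderTop_s : s.orderTop = ((-1 : ℤ) : WithTop ℤ)
  orderTop_z : (tK + s).orderTop = ((-1 : ℤ) : WithTop ℤ)

namespace Uniformised

variable {g : ℕ} {b ρ β : Fin g → ℂ} {D₁ : ℂ[X]} {f s : LaurentSeries ℂ}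

lemma mul_eq_one (U : Uniformised b ρ β D₁ f s) (i : Fin g) :
    b i * (ρ i + -β i) = 1 := by
  rw [U.eq_add]
  linear_combination -U.sq i

lemma ne_zero (U : Uniformised b ρ β D₁ f s) (i : Fin g) : b i ≠ 0 :=
  left_ne_zero_of_mul_eq_one (U.mul_eq_one i)

lemma inv_eq (U : Uniformised b ρ β D₁ f s) (i : Fin g) : (b i)⁻¹ = ρ i + -β i :=
  (eq_inv_of_mul_eq_one_right (U.mul_eq_one i)).symm

lemma beta_ne_zero (U : Uniformised b ρ β D₁ f s) (i : Fin g) : β i ≠ 0 := by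
  intro h
  have := U.sq i
  have h2 : (ρ i - 1) * (ρ i + 1) = 0 := by
    rw [h] at this
    linear_combination -this
  rcases mul_eq_zero.mp h2 with h3 | h3
  · exact (U.root_ne i).1 (by linear_combination h3)
  · exact (U.root_ne i).2 (by linear_combination h3)

lemma monic (U : Uniformised b ρ β D₁ f s) : D₁.Monic := by
  rw [U.prod_eq]
  exact monic_prod_of_monic _ _ fun i _ => monic_X_sub_C _

lemma natDegree_eq (U : Uniformised b ρ β D₁ f s) : D₁.natDegree = g := by
  rw [U.prod_eq, natDegree_prod_of_monic _ _ fun i _ => monic_X_sub_C _]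
  simp

lemma eval_eq_zero (U : Uniformised b ρ β D₁ f s) (i : Fin g) : D₁.eval (ρ i) = 0 := by
  rw [U.prod_eq, eval_prod]
  exact Finset.prod_eq_zero (Finset.mem_univ i) (by simp)

/-- A pair `(p, q)` yields a solution `P` of `P(b_i) = b_i^{2m} P(b_i⁻¹)`. -/
lemma exists_poly (U : Uniformised b ρ β D₁ f s) {m : ℕ} {p q : ℂ[X]} (hp : p.natDegree ≤ m)
    (hq : q ≠ 0 → q.natDegree + g < m) (hh : emb p - emb q * f ≠ 0) :
    ∃ P : ℂ[X], P ≠ 0 ∧ (emb p - emb q * f).order = (m : ℤ) - P.natDegree ∧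
      ∀ i, P.eval (b i) = b i ^ (2 * m) * P.eval (b i)⁻¹ := by
  have hq' : (q * D₁).degree < m := by
    by_cases hq0 : q = 0
    · simp [hq0]
    · rw [degree_mul_monic_lt_iff U.monic hq0, U.natDegree_eq]
      exact hq hq0
  obtain ⟨P, hP⟩ := exists_poly_of_pair m p (q * D₁) hp hq'
  have hPz : aeval (tK + s) P = (tK + s) ^ m * (emb p - emb q * f) := by
    rw [hP _ _ _ U.sq_s, U.eq_mul]
    simp only [emb, map_mul]
    ring
  obtain ⟨hP0, hord⟩ := order_eq_of_aeval_eq U.orderTop_z hPz hh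
  refine ⟨P, hP0, hord, fun i => ?_⟩
  have h1 := hP ℂ (ρ i) (β i) (U.sq i)
  have h2 := hP ℂ (ρ i) (-β i) (by rw [neg_sq, U.sq i])
  simp only [coe_aeval_eq_eval, eval_mul, U.eval_eq_zero, mul_zero, zero_mul, sub_zero,
    ← U.eq_add, ← U.inv_eq] at h1 h2
  rw [h1, h2, ← mul_assoc, two_mul, pow_add, mul_assoc (b i ^ m), ← mul_pow,
    mul_inv_cancel₀ (U.ne_zero i), one_pow, mul_one]

/-- A solution `P` of `P(b_i) = b_i^{2m} P(b_i⁻¹)` comes from a pair `(p, q)`. -/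
lemma exists_pair (U : Uniformised b ρ β D₁ f s) {m : ℕ} {P : ℂ[X]} (hP0 : P ≠ 0)
    (hdeg : P.natDegree ≤ 2 * m) (hP : ∀ i, P.eval (b i) = b i ^ (2 * m) * P.eval (b i)⁻¹) :
    ∃ p q : ℂ[X], p.natDegree ≤ m ∧ (q ≠ 0 → q.natDegree + g < m) ∧
      emb p - emb q * f ≠ 0 ∧ (emb p - emb q * f).order = (m : ℤ) - P.natDegree := by
  obtain ⟨p, r, hp, hr, hpr⟩ := exists_pair_of_poly m P hdeg
  have hroot : ∀ i, r.IsRoot (ρ i) := fun i => by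
    have h1 := hpr ℂ (ρ i) (β i) (U.sq i)
    have h2 := hpr ℂ (ρ i) (-β i) (by rw [neg_sq, U.sq i])
    simp only [coe_aeval_eq_eval, ← U.eq_add, ← U.inv_eq] at h1 h2
    have h3 := hP i
    rw [h1, h2, ← mul_assoc, two_mul, pow_add, mul_assoc (b i ^ m), ← mul_pow,
      mul_inv_cancel₀ (U.ne_zero i), one_pow, mul_one] at h3
    have h4 := mul_left_cancel₀ (pow_ne_zero m (U.ne_zero i)) h3
    have h5 : eval (ρ i) r * (2 * β i) = 0 := by linear_combination -h4
    exact (mul_eq_zero.mp h5).resolve_right (mul_ne_zero two_ne_zero (U.beta_ne_zero i))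
  obtain ⟨q, rfl⟩ : D₁ ∣ r := by
    rw [U.prod_eq]
    exact Finset.prod_dvd_of_coprime
      (fun i _ j _ hij => pairwise_coprime_X_sub_C U.inj hij)
      fun i _ => dvd_iff_isRoot.mpr (hroot i)
  have hz0 : tK + s ≠ 0 := by
    rw [← HahnSeries.orderTop_ne_top, U.orderTop_z]
    exact WithTop.coe_ne_top
  have hPz : aeval (tK + s) P = (tK + s) ^ m * (emb p - emb q * f) := by
    rw [hpr _ _ _ U.sq_s, U.eq_mul]
    simp only [emb, map_mul]
    ring
  have hh : emb p - emb q * f ≠ 0 := by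
    intro h
    have := orderTop_aeval U.orderTop_z hP0
    rw [hPz, h, mul_zero, HahnSeries.orderTop_zero] at this
    exact WithTop.coe_ne_top this.symm
  refine ⟨p, q, hp, fun hq => ?_, hh, (order_eq_of_aeval_eq U.orderTop_z hPz hh).2⟩
  rwa [mul_comm, degree_mul_monic_lt_iff U.monic hq, U.natDegree_eq] at hr

/-- If `p - q f` vanishes at infinity, then `deg p = deg q + g + 1`. -/
lemma natDegree_eq_of_order_pos (U : Uniformised b ρ β D₁ f s) {p q : ℂ[X]} (hq : q ≠ 0)
    (hh : emb p - emb q * f ≠ 0) (hord : 0 < (emb p - emb q * f).order) :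
    p.natDegree = q.natDegree + g + 1 := by
  have h1 : (emb q * f).orderTop = ((-((q.natDegree + g + 1 : ℕ) : ℤ) : ℤ) : WithTop ℤ) := by
    rw [U.eq_mul, HahnSeries.orderTop_mul, HahnSeries.orderTop_mul, orderTop_emb hq,
      orderTop_emb U.monic.ne_zero, U.orderTop_s, U.natDegree_eq, ← WithTop.coe_add,
      ← WithTop.coe_add]
    congr 1
    push_cast
    ring
  have h2 : (emb p).orderTop = (emb q * f).orderTop := by
    rw [← HahnSeries.orderTop_add_eq_left (x := emb q * f) (y := emb p - emb q * f)]
    · congr 1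
      ring
    · rw [h1, ← HahnSeries.order_eq_orderTop_of_ne_zero hh, WithTop.coe_lt_coe]
      omega
  have hp : p ≠ 0 := by
    rintro rfl
    rw [h1, emb, map_zero, HahnSeries.orderTop_zero] at h2
    exact WithTop.coe_ne_top h2.symm
  rw [h1, orderTop_emb hp, WithTop.coe_inj] at h2
  omega

/-- A convergent `(p, q)` with defect `l` yields a solution `P` of degree `l`, which is minimal. -/
lemma solution_of_convergent (U : Uniformised b ρ β D₁ f s) {p q : ℂ[X]} {l : ℕ} (hl : l ≤ g)
    (hpq : IsCoprime p q) (hq : q ≠ 0) (hh : emb p - emb q * f ≠ 0)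
    (hord : (emb p - emb q * f).order = (q.natDegree : ℤ) + (g + 1) - l) :
    (∃ P : ℂ[X], P ≠ 0 ∧ P.natDegree = l ∧
      ∀ i, P.eval (b i) = b i ^ (2 * p.natDegree) * P.eval (b i)⁻¹) ∧
    (∀ (m : ℕ) (P : ℂ[X]), P ≠ 0 → P.natDegree < l → m = p.natDegree ∨ m = p.natDegree - 1 →
      ¬ ∀ i, P.eval (b i) = b i ^ (2 * m) * P.eval (b i)⁻¹) := by
  have hdeg := U.natDegree_eq_of_order_pos hq hh (by omega)
  refine ⟨?_, fun m P hP0 hPl hm hP => ?_⟩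
  · obtain ⟨P, hP0, hP, hsol⟩ := U.exists_poly le_rfl (fun _ => by omega) hh
    exact ⟨P, hP0, by omega, hsol⟩
  · obtain ⟨p', q', hp', hq', hh', hord'⟩ := U.exists_pair hP0 (by omega) hP
    refine not_better_approximation hpq hq hh (by omega) (m := m) (by omega) hp' ?_ hh'
      (by omega) (by omega)
    by_cases h0 : q' = 0
    · simp [h0]
    · have := hq' h0
      omega

/-- A minimal solution of degree `l` yields a convergent. -/
lemma convergent_of_solution (U : Uniformised b ρ β D₁ f s) {n l : ℕ} (hn : 1 ≤ n)
    {P : ℂ[X]} (hP0 : P ≠ 0) (hPl : P.natDegree = l)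
    (hP : ∀ i, P.eval (b i) = b i ^ (2 * n) * P.eval (b i)⁻¹)
    (hmin : ∀ Q : ℂ[X], Q ≠ 0 → Q.natDegree < l →
      ¬ ∀ i, Q.eval (b i) = b i ^ (2 * (n - 1)) * Q.eval (b i)⁻¹) :
    ∃ p q : ℂ[X], q ≠ 0 ∧ IsCoprime p q ∧ p.natDegree = n ∧ emb p - emb q * f ≠ 0 ∧
      (emb p - emb q * f).order = (q.natDegree : ℤ) + (g + 1) - l := by
  have hln : l < n := by
    by_contra! h
    refine hmin (X ^ (n - 1)) (pow_ne_zero _ X_ne_zero) (by rw [natDegree_X_pow]; omega)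
      fun i => ?_
    rw [eval_pow, eval_pow, eval_X, eval_X, two_mul, pow_add, mul_assoc, ← mul_pow,
      mul_inv_cancel₀ (U.ne_zero i), one_pow, mul_one]
  have hnone : ∀ p' q' : ℂ[X], p'.natDegree ≤ n - 1 → (q' ≠ 0 → q'.natDegree + g < n - 1) →
      emb p' - emb q' * f ≠ 0 → (n : ℤ) - l ≤ (emb p' - emb q' * f).order → False := by
    intro p' q' hp' hq' hh' hord'
    obtain ⟨Q, hQ0, hQ, hsol⟩ := U.exists_poly hp' hq' hh'
    exact hmin Q hQ0 (by omega) hsol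
  obtain ⟨p, q, hp, hq, hh, hord⟩ := U.exists_pair hP0 (by omega) hP
  have hq0 : q ≠ 0 := by
    rintro rfl
    simp only [emb, map_zero, zero_mul, sub_zero] at hh hord
    have hp0 : p ≠ 0 := by
      rintro rfl
      simp at hh
    have := orderTop_emb hp0
    rw [emb, ← HahnSeries.order_eq_orderTop_of_ne_zero hh, WithTop.coe_inj] at this
    omega
  have hq := hq hq0
  have hdeg := U.natDegree_eq_of_order_pos hq0 hh (by omega)
  have hpn : p.natDegree = n := by
    by_contra h
    exact hnone p q (by omega) (fun _ => by omega) hh (by omega)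
  refine ⟨p, q, hq0, ?_, hpn, hh, by omega⟩
  rw [← EuclideanDomain.gcd_isUnit_iff]
  by_contra hu
  obtain ⟨p', hp'⟩ := EuclideanDomain.gcd_dvd_left p q
  obtain ⟨q', hq'⟩ := EuclideanDomain.gcd_dvd_right p q
  generalize EuclideanDomain.gcd p q = c at hu hp' hq'
  subst hp' hq'
  have hc0 : c ≠ 0 := left_ne_zero_of_mul hq0
  have hq'0 : q' ≠ 0 := right_ne_zero_of_mul hq0
  have hp'0 : p' ≠ 0 := by
    rintro rfl
    simp at hpn
    omega
  have hc1 : 1 ≤ c.natDegree := by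
    by_contra! h
    exact hu (isUnit_iff_degree_eq_zero.mpr (by
      rw [degree_eq_natDegree hc0]
      exact_mod_cast Nat.lt_one_iff.mp h))
  rw [natDegree_mul hc0 hp'0] at hpn
  rw [natDegree_mul hc0 hq'0] at hq
  have hfac : emb (c * p') - emb (c * q') * f = emb c * (emb p' - emb q' * f) := by
    simp only [emb, map_mul]
    ring
  rw [hfac] at hh hord
  have hh' := right_ne_zero_of_mul hh
  have hco := orderTop_emb hc0
  rw [← HahnSeries.order_eq_orderTop_of_ne_zero (emb_ne_zero hc0), WithTop.coe_inj] at hco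
  rw [HahnSeries.order_mul (emb_ne_zero hc0) hh', hco] at hord
  exact hnone p' q' (by omega) (fun _ => by omega) hh' (by omega)

end Uniformised

/-- Theorem on the correspondence between powers of `δ` in the `W_l` and the convergents of
`√D`: condition (a) `δ^n ∈ cl(W_l) ∖ cl(W_{l-1})` and `δ^{n-1} ∉ cl(W_{l-1})` holds iff (b) there
is a convergent `(p, q)` of `f` with `deg p = n` and `ord(p − q f) = deg q + d − l`. -/
theorem stmt9 (g : ℕ) (hg : 1 ≤ g) (ρ β b : Fin g → ℂ)
    (hρdist : Function.Injective ρ) (hρ1 : ∀ i, ρ i ≠ 1 ∧ ρ i ≠ -1)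
    (hβ : ∀ i, β i ^ 2 = ρ i ^ 2 - 1) (hbdef : ∀ i, b i = ρ i + β i)
    (hbinj : Function.Injective b) (hbInv : ∀ i j, b i ≠ (b j)⁻¹)
    (D₁ D : Polynomial ℂ)
    (hD₁ : D₁ = ∏ i, (Polynomial.X - Polynomial.C (ρ i)))
    (hD : D = (Polynomial.X ^ 2 - 1) * D₁ ^ 2)
    (d : ℕ) (hd : d = g + 1)
    (f : LaurentSeries ℂ) (hf2 : f ^ 2 = emb D) (hlead : f.coeff (-(d : ℤ)) = 1)
    (n : ℕ) (hn : 1 ≤ n) (l : ℕ) (hl : l ≤ g) :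
    ((fun i => b i ^ (2 * n)) ∈ closT (Wn b l) ∧
     (fun i => b i ^ (2 * n)) ∉ closT (W b ((l : ℤ) - 1)) ∧
     (fun i => b i ^ (2 * (n - 1))) ∉ closT (W b ((l : ℤ) - 1))) ↔
    (∃ p q : Polynomial ℂ, IsConvergent f p q ∧ p.natDegree = n ∧
      ordE (emb p - emb q * f) =
        (((q.natDegree : ℤ) + d - l : ℤ) : WithTop ℤ)) := by
  subst hd hD
  have hmonic : D₁.Monic := hD₁ ▸ monic_prod_of_monic _ _ fun i _ => monic_X_sub_C _
  have hnat : D₁.natDegree = g := by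
    rw [hD₁, natDegree_prod_of_monic _ _ fun i _ => monic_X_sub_C _]
    simp
  obtain ⟨s, hs, hfs, hs1, hz⟩ := exists_sqrt_factor hmonic hf2 (by rwa [hnat])
  have U : Uniformised b ρ β D₁ f s := ⟨hbdef, hβ, hρ1, hρdist, hD₁, hs, hfs, hs1, hz⟩
  have hpow : ∀ m i, b i ^ (2 * m) ≠ 0 := fun m i => pow_ne_zero _ (U.ne_zero i)
  have hWn : closT (Wn b l) = closT (W b (((l + 1 : ℕ) : ℤ) - 1)) := by
    congr 1
    ext x
    exact ⟨fun h => ⟨l, by push_cast; ring, h⟩, fun ⟨m, hm, h⟩ => by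
      obtain rfl : m = l := by omega
      exact h⟩
  have hmem : ∀ k m : ℕ, (fun i => b i ^ (2 * m)) ∈ closT (W b ((k : ℤ) - 1)) ↔
      ∃ P : ℂ[X], P ≠ 0 ∧ P.natDegree < k ∧
        ∀ i, P.eval (b i) = b i ^ (2 * m) * P.eval (b i)⁻¹ := fun k m => by
    rw [mem_closT_W_iff hbinj hbInv k (hpow m)]
    exact exists_congr fun P => and_congr_right fun hP0 => by
      rw [natDegree_lt_iff_degree_lt hP0]
  rw [hWn, hmem, hmem, hmem]
  constructor
  · rintro ⟨⟨P, hP0, hPl, hP⟩, hmin, hmin'⟩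
    have hPl' : P.natDegree = l := by
      by_contra h
      exact hmin ⟨P, hP0, by omega, hP⟩
    obtain ⟨p, q, hq0, hpq, hpn, hh, hord⟩ := U.convergent_of_solution hn hP0 hPl' hP
      fun Q hQ0 hQl hQ => hmin' ⟨Q, hQ0, hQl, hQ⟩
    refine ⟨p, q, ⟨hq0, hpq, ?_⟩, hpn, ?_⟩
    · rw [ordE_eq_orderTop, ← HahnSeries.order_eq_orderTop_of_ne_zero hh, WithTop.coe_le_coe]
      omega
    · rw [ordE_eq_orderTop, ← HahnSeries.order_eq_orderTop_of_ne_zero hh, WithTop.coe_inj, hord]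
      push_cast
      ring
  · rintro ⟨p, q, ⟨hq0, hpq, -⟩, hpn, hord⟩
    rw [ordE_eq_orderTop] at hord
    have hh : emb p - emb q * f ≠ 0 := by
      rw [← HahnSeries.orderTop_ne_top, hord]
      exact WithTop.coe_ne_top
    rw [← HahnSeries.order_eq_orderTop_of_ne_zero hh, WithTop.coe_inj] at hord
    obtain ⟨⟨P, hP0, hPl, hP⟩, hmin⟩ :=
      U.solution_of_convergent hl hpq hq0 hh (by rw [hord]; push_cast; ring)
    rw [hpn] at hP hmin
    exact ⟨⟨P, hP0, by omega, hP⟩,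
      fun ⟨Q, hQ0, hQl, hQ⟩ => hmin n Q hQ0 hQl (Or.inl rfl) hQ,
      fun ⟨Q, hQ0, hQl, hQ⟩ => hmin (n - 1) Q hQ0 hQl (Or.inr rfl) hQ⟩
end
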